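/- Let H be a hyperplane of T and u ∈ V' with r·u ∉ H. Then any two distinct vertices from C(H,u) have exactly q^{4e-3} − q^{4e-4} − q^{2e-2} common neighbours in the graph Y(2e,K). -/

import Mathlib

open Matrix

/-- The symplectic form `a M bᵀ` where `M = [[0, Iₑ],[-Iₑ, 0]]`. -/
def sympForm (K : Type) [CommRing K] (e : ℕ) (a b : Fin e ⊕ Fin e → K) : K :=
  a ⬝ᵥ ((Matrix.fromBlocks (0 : Matrix (Fin e) (Fin e) K) 1 (-1) 0) *ᵥ b)

/-- `V'`: the set of 2e-tuples over `K` having at least one unit entry. -/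
def unitTuples (K : Type) [CommRing K] (e : ℕ) : Set (Fin e ⊕ Fin e → K) :=
  {a | ∃ i, IsUnit (a i)}

/-- The equivalence class `[a]` of a tuple under unit scaling. -/
def cls (K : Type) [CommRing K] (e : ℕ) (a : Fin e ⊕ Fin e → K) :
    Set (Fin e ⊕ Fin e → K) :=
  {b | ∃ σ : Kˣ, b = σ • a}

/-- `V`: the set of equivalence classes of elements of `V'` under unit scaling. -/
def classes (K : Type) [CommRing K] (e : ℕ) : Set (Set (Fin e ⊕ Fin e → K)) :=
  {S | ∃ a ∈ unitTuples K e, S = cls K e a}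

/-- Adjacency in the graph `X(2e,K)`: `a M bᵀ ∈ K \ {0}`. -/
def adjX (K : Type) [CommRing K] (e : ℕ) (A B : Set (Fin e ⊕ Fin e → K)) : Prop :=
  ∃ a ∈ A, ∃ b ∈ B, sympForm K e a b ≠ 0

/-- Adjacency in the complement of `X(2e,K)`: distinct classes with `a M bᵀ = 0`. -/
def adjXc (K : Type) [CommRing K] (e : ℕ) (A B : Set (Fin e ⊕ Fin e → K)) : Prop :=
  A ≠ B ∧ ∃ a ∈ A, ∃ b ∈ B, sympForm K e a b = 0

/-- Adjacency in the graph `Y(2e,K)`: `a M bᵀ ∈ J \ {0}`. -/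
def adjY (K : Type) [CommRing K] (J : Ideal K) (e : ℕ)
    (A B : Set (Fin e ⊕ Fin e → K)) : Prop :=
  ∃ a ∈ A, ∃ b ∈ B, sympForm K e a b ∈ J ∧ sympForm K e a b ≠ 0

/-- `T = J × ⋯ × J` (2e factors), as a subset of `K^{2e}`. -/
def Tset (K : Type) [CommRing K] (J : Ideal K) (e : ℕ) : Set (Fin e ⊕ Fin e → K) :=
  {x | ∀ i, x i ∈ J}

/-- A hyperplane of `T`: a `K`-submodule contained in `T` of cardinality `q^(2e-1)`. -/
def IsHyperplane (K : Type) [CommRing K] (J : Ideal K) (e q : ℕ)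
    (H : Submodule K (Fin e ⊕ Fin e → K)) : Prop :=
  (H : Set (Fin e ⊕ Fin e → K)) ⊆ Tset K J e ∧ Nat.card H = q ^ (2 * e - 1)

/-- `C(H,u) = {[u+h] : h ∈ H}`. -/
def classSet (K : Type) [CommRing K] (e : ℕ) (H : Submodule K (Fin e ⊕ Fin e → K))
    (u : Fin e ⊕ Fin e → K) : Set (Set (Fin e ⊕ Fin e → K)) :=
  {S | ∃ h ∈ (H : Set (Fin e ⊕ Fin e → K)), S = cls K e (u + h)}

/-- The set of tuples `{σ • (u+h) : σ ∈ Kˣ, h ∈ H}`. -/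
def orbitSet (K : Type) [CommRing K] (e : ℕ) (H : Submodule K (Fin e ⊕ Fin e → K))
    (u : Fin e ⊕ Fin e → K) : Set (Fin e ⊕ Fin e → K) :=
  {x | ∃ σ : Kˣ, ∃ h ∈ (H : Set (Fin e ⊕ Fin e → K)), x = σ • (u + h)}

/-- The coset `c • u + T` of `T`. -/
def cosetOf (K : Type) [CommRing K] (J : Ideal K) (e : ℕ) (c : K)
    (u : Fin e ⊕ Fin e → K) : Set (Fin e ⊕ Fin e → K) :=
  {x | ∃ t ∈ Tset K J e, x = c • u + t}

theorem AddMonoidHom.ncard_preimage_mul_card {G G' : Type*} [AddCommGroup G] [AddCommGroup G']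
    (f : G →+ G') (hf : Function.Surjective f) (A : Set G') :
    (f ⁻¹' A).ncard * Nat.card G' = A.ncard * Nat.card G := by
  have key : ∀ B : Set G', (f ⁻¹' B).ncard = B.ncard * Nat.card f.ker := by
    intro B
    rw [← Nat.card_coe_set_eq, ← Nat.card_coe_set_eq, ← Nat.card_prod]
    refine Nat.card_congr
      { toFun := fun x => (⟨f x, x.2⟩, ⟨x - Function.surjInv hf (f x), ?_⟩)
        invFun := fun y => ⟨Function.surjInv hf y.1 + y.2, ?_⟩
        left_inv := ?_
        right_inv := ?_ }
    · simp [AddMonoidHom.mem_ker, Function.surjInv_eq]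
    · have h : f (y.2 : G) = 0 := y.2.2
      simp [h, Function.surjInv_eq]
    · intro x
      simp
    · rintro ⟨⟨y, hy⟩, ⟨k, hk⟩⟩
      have h : f k = 0 := hk
      simp [h, Function.surjInv_eq]
  have huniv := key Set.univ
  rw [Set.preimage_univ, Set.ncard_univ, Set.ncard_univ] at huniv
  rw [key, huniv]
  ring

section UniqueIdeal

variable {K : Type} [CommRing K] {J : Ideal K} {r : K}

theorem isUnit_iff_notMem_of_ideals (hJtop : J ≠ ⊤)
    (hideals : ∀ I : Ideal K, I = ⊥ ∨ I = J ∨ I = ⊤) (x : K) : IsUnit x ↔ x ∉ J := by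
  refine ⟨fun hx hxJ => hJtop (J.eq_top_of_isUnit_mem hxJ hx), fun hx => ?_⟩
  have hmem : x ∈ Ideal.span {x} := Ideal.mem_span_singleton_self x
  rcases hideals (Ideal.span {x}) with h | h | h
  · rw [h, Ideal.mem_bot] at hmem
    exact absurd (hmem ▸ J.zero_mem) hx
  · exact absurd (h ▸ hmem) hx
  · exact Ideal.span_singleton_eq_top.mp h

theorem generator_mul_self_eq_zero (hJr : J = Ideal.span {r}) (hJtop : J ≠ ⊤)
    (hideals : ∀ I : Ideal K, I = ⊥ ∨ I = J ∨ I = ⊤) : r * r = 0 := by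
  have hrJ : r ∈ J := hJr ▸ Ideal.mem_span_singleton_self r
  have hmem : r * r ∈ Ideal.span {r * r} := Ideal.mem_span_singleton_self _
  rcases hideals (Ideal.span {r * r}) with h | h | h
  · simpa [h] using hmem
  · obtain ⟨s, hs⟩ := Ideal.mem_span_singleton'.mp (h.symm ▸ hrJ)
    have hunit : IsUnit (1 - s * r) := by
      rw [isUnit_iff_notMem_of_ideals hJtop hideals]
      intro h1
      exact hJtop ((Ideal.eq_top_iff_one J).mpr
        (by simpa using J.add_mem h1 (J.mul_mem_left s hrJ)))
    have hr0 : (1 - s * r) * r = 0 := by linear_combination -hs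
    have : r = 0 := (hunit.mul_right_eq_zero).mp hr0
    simp [this]
  · exact absurd (Ideal.span_singleton_eq_top.mp h)
      (fun hu => (isUnit_iff_notMem_of_ideals hJtop hideals _).mp hu (J.mul_mem_left r hrJ))

theorem mul_generator_eq_zero_iff (hJr : J = Ideal.span {r}) (hJbot : J ≠ ⊥) (hJtop : J ≠ ⊤)
    (hideals : ∀ I : Ideal K, I = ⊥ ∨ I = J ∨ I = ⊤) (x : K) : r * x = 0 ↔ x ∈ J := by
  constructor
  · intro hx
    by_contra hxJ
    have hu := (isUnit_iff_notMem_of_ideals hJtop hideals x).mpr hxJ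
    have : r = 0 := (hu.mul_left_eq_zero).mp hx
    exact hJbot (by simp [hJr, this])
  · intro hx
    obtain ⟨s, rfl⟩ := Ideal.mem_span_singleton'.mp (hJr ▸ hx)
    linear_combination s * generator_mul_self_eq_zero hJr hJtop hideals

/-- Multiplication by the generator, as a homomorphism onto the ideal. -/
def mulGenerator (hJr : J = Ideal.span {r}) : K →+ J where
  toFun x := ⟨r * x, hJr ▸ Ideal.mem_span_singleton'.mpr ⟨x, mul_comm _ _⟩⟩
  map_zero' := by simp
  map_add' x y := by ext; simp [mul_add]

theorem mulGenerator_surjective (hJr : J = Ideal.span {r}) :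
    Function.Surjective (mulGenerator hJr) := by
  rintro ⟨x, hx⟩
  obtain ⟨s, hs⟩ := Ideal.mem_span_singleton'.mp (hJr ▸ hx)
  exact ⟨s, Subtype.ext (by simp [mulGenerator, ← hs, mul_comm])⟩

theorem card_generated_ideal [Finite K] (hJr : J = Ideal.span {r}) (hJbot : J ≠ ⊥)
    (hJtop : J ≠ ⊤) (hideals : ∀ I : Ideal K, I = ⊥ ∨ I = J ∨ I = ⊤) :
    Nat.card J = Nat.card (K ⧸ J) := by
  have h := (mulGenerator hJr).ncard_preimage_mul_card (mulGenerator_surjective hJr) {0}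
  have hpre : mulGenerator hJr ⁻¹' {0} = (J : Set K) := by
    ext x
    simp [mulGenerator, mul_generator_eq_zero_iff hJr hJbot hJtop hideals, Subtype.ext_iff]
  have hcard := Submodule.card_eq_card_quotient_mul_card J
  rw [hpre, Set.ncard_singleton, one_mul, hcard, ← Nat.card_coe_set_eq] at h
  exact Nat.eq_of_mul_eq_mul_left (Nat.card_pos (α := J)) h

theorem card_units_add_card [Finite K] (hJtop : J ≠ ⊤)
    (hideals : ∀ I : Ideal K, I = ⊥ ∨ I = J ∨ I = ⊤) :
    Nat.card Kˣ + Nat.card J = Nat.card K := by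
  have h : Nat.card Kˣ = ((J : Set K)ᶜ).ncard := by
    rw [← Nat.card_coe_set_eq]
    refine Nat.card_congr (Equiv.ofBijective
      (fun σ => ⟨(σ : K), (isUnit_iff_notMem_of_ideals hJtop hideals _).mp σ.isUnit⟩) ⟨?_, ?_⟩)
    · intro σ τ h
      exact Units.ext (congrArg Subtype.val h)
    · rintro ⟨x, hx⟩
      obtain ⟨σ, hσ⟩ := (isUnit_iff_notMem_of_ideals hJtop hideals x).mpr hx
      exact ⟨σ, Subtype.ext hσ⟩
  have h2 := Set.ncard_add_ncard_compl (J : Set K)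
  rw [h, add_comm, ← h2, ← Nat.card_coe_set_eq (J : Set K)]
  rfl

end UniqueIdeal

section DotProductCounts

variable {K : Type} [CommRing K] {J : Ideal K} {r : K} {ι : Type} [Fintype ι]

/-- If two vectors have an invertible `2 × 2` minor, then dotting with them is onto `K × K`. -/
theorem exists_dotProduct_eq {α ω : ι → K} {i j : ι}
    (hD : IsUnit (α i * ω j - α j * ω i)) (x y : K) :
    ∃ c : ι → K, c ⬝ᵥ α = x ∧ c ⬝ᵥ ω = y := by
  classical
  obtain ⟨d, hd⟩ := hD.exists_right_inv
  refine ⟨Pi.single i (d * (ω j * x - α j * y)) + Pi.single j (d * (α i * y - ω i * x)), ?_, ?_⟩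
  · simp only [add_dotProduct, single_dotProduct]
    linear_combination x * hd
  · simp only [add_dotProduct, single_dotProduct]
    linear_combination y * hd

theorem ncard_nonzero_ideal [Finite K] :
    {x : K | x ∈ J ∧ x ≠ 0}.ncard = Nat.card J - 1 := by
  have : {x : K | x ∈ J ∧ x ≠ 0} = (J : Set K) \ {0} := by ext; simp
  rw [this, Set.ncard_sdiff_singleton_of_mem J.zero_mem, ← Nat.card_coe_set_eq]
  rfl

theorem ncard_tuples_forms_ne_zero [Finite K] (hJr : J = Ideal.span {r}) {α ω : ι → K} {i j : ι}
    (hD : IsUnit (α i * ω j - α j * ω i)) :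
    {c : ι → K | (c ⬝ᵥ α ∈ J ∧ c ⬝ᵥ α ≠ 0) ∧ c ⬝ᵥ α + r * (c ⬝ᵥ ω) ≠ 0}.ncard *
        (Nat.card K * Nat.card J) =
      (Nat.card J - 1) ^ 2 * Nat.card (ι → K) := by
  let f : (ι → K) →+ K × J :=
    { toFun := fun c => (c ⬝ᵥ α, mulGenerator hJr (c ⬝ᵥ ω))
      map_zero' := by simp
      map_add' := fun c d => by simp [add_dotProduct] }
  have hf : Function.Surjective f := by
    rintro ⟨x, y⟩
    obtain ⟨z, rfl⟩ := mulGenerator_surjective hJr y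
    obtain ⟨c, rfl, rfl⟩ := exists_dotProduct_eq hD x z
    exact ⟨c, rfl⟩
  let A : Set (K × J) := {p | (p.1 ∈ J ∧ p.1 ≠ 0) ∧ p.1 + p.2 ≠ 0}
  have hA : A.ncard = (Nat.card J - 1) ^ 2 := by
    rw [← ncard_nonzero_ideal, sq, ← Set.ncard_prod]
    refine Set.ncard_congr (fun p _ => (p.1, p.1 + (p.2 : K))) ?_ ?_ ?_
    · rintro ⟨x, y⟩ ⟨h1, h2⟩
      exact ⟨h1, J.add_mem h1.1 y.2, h2⟩
    · rintro ⟨x, y⟩ ⟨x', y'⟩ - - h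
      simp only [Prod.mk.injEq] at h
      obtain ⟨rfl, h⟩ := h
      rw [Subtype.ext (add_left_cancel h)]
    · rintro ⟨x, y⟩ ⟨hx, hy⟩
      exact ⟨(x, ⟨y - x, J.sub_mem hy.1 hx.1⟩), ⟨hx, by simpa using hy.2⟩, by simp⟩
  have h := f.ncard_preimage_mul_card hf A
  rw [hA, Nat.card_prod] at h
  exact h

theorem ncard_ideal_tuples_form_ne_zero [Finite K] {α : ι → K} (hα : ∃ i, IsUnit (α i)) :
    {c : ι → K | (∀ i, c i ∈ J) ∧ c ⬝ᵥ α ≠ 0}.ncard * Nat.card J =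
      (Nat.card J - 1) * Nat.card (ι → J) := by
  classical
  have hmem : ∀ c : ι → J, (∑ i, (c i : K) * α i) ∈ J :=
    fun c => J.sum_mem fun i _ => J.mul_mem_right _ (c i).2
  let f : (ι → J) →+ J :=
    { toFun := fun c => ⟨∑ i, (c i : K) * α i, hmem c⟩
      map_zero' := by simp
      map_add' := fun c d => by ext; simp [add_mul, Finset.sum_add_distrib] }
  have hf : Function.Surjective f := by
    rintro ⟨x, hx⟩
    obtain ⟨i, hi⟩ := hα
    obtain ⟨d, hd⟩ := hi.exists_right_inv
    refine ⟨Pi.single i ⟨x * d, J.mul_mem_right _ hx⟩, Subtype.ext ?_⟩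
    change ∑ k, ((Pi.single i ⟨x * d, _⟩ : ι → J) k : K) * α k = x
    rw [Finset.sum_eq_single i]
    · simp only [Pi.single_eq_same]
      linear_combination x * hd
    · intro k _ hk
      simp [Pi.single_eq_of_ne hk]
    · simp
  have h := f.ncard_preimage_mul_card hf {x | x ≠ 0}
  have h0 : {x : J | x ≠ 0}.ncard = Nat.card J - 1 := by
    have : {x : J | x ≠ 0} = Set.univ \ {0} := by ext; simp
    rw [this, Set.ncard_sdiff_singleton_of_mem (Set.mem_univ _), Set.ncard_univ]
  have h1 : (f ⁻¹' {x | x ≠ 0}).ncard =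
      {c : ι → K | (∀ i, c i ∈ J) ∧ c ⬝ᵥ α ≠ 0}.ncard := by
    refine Set.ncard_congr (fun c _ i => (c i : K)) ?_ ?_ ?_
    · intro c hc
      exact ⟨fun i => (c i).2, fun h0 => hc (Subtype.ext h0)⟩
    · intro c d _ _ hcd
      exact funext fun i => Subtype.ext (congrFun hcd i)
    · rintro c ⟨hc, h0⟩
      exact ⟨fun i => ⟨c i, hc i⟩, fun h => h0 (congrArg Subtype.val h), rfl⟩
  rw [h0, h1] at h
  exact h

end DotProductCounts

section Classes

variable {K : Type} [CommRing K] {J : Ideal K} {e : ℕ}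

theorem mem_cls_self (a : Fin e ⊕ Fin e → K) : a ∈ cls K e a := ⟨1, by simp⟩

theorem cls_units_smul (σ : Kˣ) (a : Fin e ⊕ Fin e → K) : cls K e (σ • a) = cls K e a := by
  ext b
  constructor
  · rintro ⟨τ, rfl⟩
    exact ⟨τ * σ, by rw [mul_smul]⟩
  · rintro ⟨τ, rfl⟩
    exact ⟨τ * σ⁻¹, by rw [mul_smul, inv_smul_smul]⟩

theorem ncard_image_cls_mul_card_units {S : Set (Fin e ⊕ Fin e → K)}
    (hS : S ⊆ unitTuples K e) (hsmul : ∀ (σ : Kˣ), ∀ c ∈ S, σ • c ∈ S) :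
    (cls K e '' S).ncard * Nat.card Kˣ = S.ncard := by
  rw [← Nat.card_coe_set_eq, ← Nat.card_coe_set_eq, ← Nat.card_prod]
  choose rep hrepS hrep using fun C : ↥(cls K e '' S) => C.2
  refine Nat.card_congr (Equiv.ofBijective
    (fun p => ⟨p.2 • rep p.1, hsmul _ _ (hrepS p.1)⟩) ⟨?_, ?_⟩)
  · rintro ⟨C, σ⟩ ⟨D, τ⟩ h
    have h' : σ • rep C = τ • rep D := congrArg Subtype.val h
    have hCD : C = D := by
      apply Subtype.ext
      rw [← hrep C, ← hrep D, ← cls_units_smul σ, h', cls_units_smul]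
    subst hCD
    obtain ⟨i, hi⟩ := hS (hrepS C)
    have hi' : (σ : K) * rep C i = τ * rep C i := congrFun h' i
    rw [Units.ext (hi.mul_right_cancel hi')]
  · rintro ⟨c, hc⟩
    obtain ⟨σ, hσ⟩ : c ∈ cls K e (rep ⟨cls K e c, c, hc, rfl⟩) := by
      rw [hrep]
      exact mem_cls_self c
    exact ⟨(⟨cls K e c, c, hc, rfl⟩, σ), Subtype.ext hσ.symm⟩

theorem sympForm_units_smul (σ τ : Kˣ) (c a : Fin e ⊕ Fin e → K) :
    sympForm K e (σ • c) (τ • a) = ((σ * τ : Kˣ) : K) * sympForm K e c a := by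
  simp only [sympForm, Units.smul_def, mulVec_smul, smul_dotProduct, dotProduct_smul, smul_eq_mul,
    Units.val_mul]
  ring

theorem adjY_cls_iff (c a : Fin e ⊕ Fin e → K) :
    adjY K J e (cls K e c) (cls K e a) ↔ sympForm K e c a ∈ J ∧ sympForm K e c a ≠ 0 := by
  constructor
  · rintro ⟨_, ⟨σ, rfl⟩, _, ⟨τ, rfl⟩, h1, h2⟩
    rw [sympForm_units_smul] at h1 h2
    exact ⟨(Ideal.unit_mul_mem_iff_mem J (σ * τ).isUnit).mp h1, right_ne_zero_of_mul h2⟩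
  · exact fun h => ⟨c, mem_cls_self c, a, mem_cls_self a, h⟩

/-- The matrix `M = [[0, Iₑ],[-Iₑ, 0]]` applied to a vector. -/
def sympDual (K : Type) [CommRing K] (e : ℕ) (a : Fin e ⊕ Fin e → K) : Fin e ⊕ Fin e → K :=
  (Matrix.fromBlocks (0 : Matrix (Fin e) (Fin e) K) 1 (-1) 0) *ᵥ a

theorem sympDual_inl (a : Fin e ⊕ Fin e → K) (i : Fin e) :
    sympDual K e a (Sum.inl i) = a (Sum.inr i) := by
  simp [sympDual, fromBlocks_mulVec]

theorem sympDual_inr (a : Fin e ⊕ Fin e → K) (i : Fin e) :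
    sympDual K e a (Sum.inr i) = -a (Sum.inl i) := by
  simp [sympDual, fromBlocks_mulVec, neg_mulVec]

theorem exists_isUnit_sympDual {a : Fin e ⊕ Fin e → K} (ha : a ∈ unitTuples K e) :
    ∃ i, IsUnit (sympDual K e a i) := by
  obtain ⟨i | i, hi⟩ := ha
  · exact ⟨Sum.inr i, by rw [sympDual_inr]; exact hi.neg⟩
  · exact ⟨Sum.inl i, by rwa [sympDual_inl]⟩

theorem eq_zero_of_sympDual_eq_zero {a : Fin e ⊕ Fin e → K} (ha : sympDual K e a = 0) : a = 0 := by
  ext (i | i)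
  · simpa [sympDual_inr] using congrFun ha (Sum.inr i)
  · simpa [sympDual_inl] using congrFun ha (Sum.inl i)

theorem exists_isUnit_minor {r : K} (hJr : J = Ideal.span {r}) (hJbot : J ≠ ⊥) (hJtop : J ≠ ⊤)
    (hideals : ∀ I : Ideal K, I = ⊥ ∨ I = J ∨ I = ⊤)
    {H : Submodule K (Fin e ⊕ Fin e → K)} {a w : Fin e ⊕ Fin e → K}
    (ha : a ∈ unitTuples K e) (hw : r • w ∈ H) (hw0 : r • w ≠ 0) (hra : r • a ∉ H) :
    ∃ i j, IsUnit (sympDual K e a i * sympDual K e w j - sympDual K e a j * sympDual K e w i) := by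
  by_contra! hcon
  obtain ⟨i, hi⟩ := exists_isUnit_sympDual ha
  set s := sympDual K e a i with hs
  set t := sympDual K e w i with ht
  have hzero : s • r • w - t • r • a = 0 := by
    apply eq_zero_of_sympDual_eq_zero
    ext j
    have hj : s * sympDual K e w j - sympDual K e a j * t ∈ J := by
      by_contra h
      exact hcon i j ((isUnit_iff_notMem_of_ideals hJtop hideals _).mpr h)
    have hj' := (mul_generator_eq_zero_iff hJr hJbot hJtop hideals _).mpr hj
    have hlin : sympDual K e (s • r • w - t • r • a) j =
        s * (r * sympDual K e w j) - t * (r * sympDual K e a j) := by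
      simp [sympDual, mulVec_sub, mulVec_smul]
    rw [hlin, Pi.zero_apply]
    linear_combination hj'
  have heq := sub_eq_zero.mp hzero
  by_cases htJ : t ∈ J
  · have htr := (mul_generator_eq_zero_iff hJr hJbot hJtop hideals _).mpr htJ
    rw [smul_smul t, mul_comm, htr, zero_smul] at heq
    exact hw0 (hi.smul_eq_zero.mp heq)
  · have hmem : t • r • a ∈ H := heq ▸ H.smul_mem s hw
    exact hra ((H.smul_mem_iff_of_isUnit
      ((isUnit_iff_notMem_of_ideals hJtop hideals t).mpr htJ)).mp hmem)

end Classes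

theorem common_neighbour_count_arith {q e X U N NT NA : ℕ} (hq : 2 ≤ q) (he : 2 ≤ e)
    (hX : X * U = N) (hU : U + q = q * q) (hN : N + NT = NA)
    (hNT : NT * q = (q - 1) * q ^ (2 * e))
    (hNA : NA * (q * q * q) = (q - 1) ^ 2 * (q * q) ^ (2 * e)) :
    X = q ^ (4 * e - 3) - q ^ (4 * e - 4) - q ^ (2 * e - 2) := by
  obtain ⟨p, rfl⟩ : ∃ p, q = p + 1 := ⟨q - 1, by omega⟩
  obtain ⟨m, rfl⟩ : ∃ m, e = m + 2 := ⟨e - 2, by omega⟩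
  rw [show p + 1 - 1 = p by omega] at hNT hNA
  rw [show 4 * (m + 2) - 3 = (4 * m + 4) + 1 by omega, show 4 * (m + 2) - 4 = 4 * m + 4 by omega,
    show 2 * (m + 2) - 2 = 2 * m + 2 by omega]
  have hp : 0 < p := by omega
  have hU' : U = p * (p + 1) := by nlinarith
  have hNT' : NT = p * (p + 1) * (p + 1) ^ (2 * m + 2) := by
    apply Nat.eq_of_mul_eq_mul_right (Nat.succ_pos p)
    change NT * (p + 1) = _ * (p + 1)
    rw [hNT]; ring
  have hNA' : NA = p * (p + 1) * (p * (p + 1) ^ (4 * m + 4)) := by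
    apply Nat.eq_of_mul_eq_mul_right (show 0 < (p + 1) * (p + 1) * (p + 1) by positivity)
    rw [hNA, mul_pow]; ring
  have hfin : X + (p + 1) ^ (2 * m + 2) = p * (p + 1) ^ (4 * m + 4) := by
    apply Nat.eq_of_mul_eq_mul_left (show 0 < p * (p + 1) by positivity)
    rw [← hNA', ← hN, hNT', ← hX, hU']
    ring
  have hpow : (p + 1) ^ (4 * m + 4 + 1) = p * (p + 1) ^ (4 * m + 4) + (p + 1) ^ (4 * m + 4) := by
    ring
  omega

/-- Proposition: any two distinct vertices from a class `C(H,u)` have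
`q^(4e-3) - q^(4e-4) - q^(2e-2)` common neighbours in `Y(2e,K)`. -/
theorem common_neighbours_Y_same_class
    (K : Type) [CommRing K] [Fintype K]
    (J : Ideal K) (r : K) (q : ℕ)
    (hJr : J = Ideal.span {r})
    (hJbot : J ≠ ⊥) (hJtop : J ≠ ⊤)
    (hideals : ∀ I : Ideal K, I = ⊥ ∨ I = J ∨ I = ⊤)
    (hq : IsPrimePow q)
    (hqcard : Nat.card (K ⧸ J) = q)
    (e : ℕ) (he : 2 ≤ e)
    (H : Submodule K (Fin e ⊕ Fin e → K)) (hH : IsHyperplane K J e q H)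
    (u : Fin e ⊕ Fin e → K) (hu : u ∈ unitTuples K e) (hru : r • u ∉ H)
    (a b : Fin e ⊕ Fin e → K)
    (ha : a ∈ unitTuples K e) (hb : b ∈ unitTuples K e)
    (haC : cls K e a ∈ classSet K e H u) (hbC : cls K e b ∈ classSet K e H u)
    (hab : cls K e a ≠ cls K e b) :
    Nat.card ↥{C ∈ classes K e | adjY K J e C (cls K e a) ∧ adjY K J e C (cls K e b)} =
      q ^ (4 * e - 3) - q ^ (4 * e - 4) - q ^ (2 * e - 2) := by
  obtain ⟨h₁, hh₁, haC⟩ := haC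
  obtain ⟨h₂, hh₂, hbC⟩ := hbC
  rw [haC, hbC] at hab ⊢
  have hunit := isUnit_iff_notMem_of_ideals hJtop hideals
  have hann := mul_generator_eq_zero_iff hJr hJbot hJtop hideals
  have hcJ : Nat.card J = q := (card_generated_ideal hJr hJbot hJtop hideals).trans hqcard
  have hcK : Nat.card K = q * q := by
    rw [Submodule.card_eq_card_quotient_mul_card J, hcJ, hqcard]
  have hJ1 : ∀ {x y : K}, x ∈ J → y ∉ J → y + x ∉ J := fun hx hy h =>
    hy ((J.add_mem_iff_left hx).mp h)
  have ha' : u + h₁ ∈ unitTuples K e := by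
    obtain ⟨i, hi⟩ := hu
    exact ⟨i, (hunit _).mpr (hJ1 (hH.1 hh₁ i) ((hunit _).mp hi))⟩
  have hdH : h₂ - h₁ ∈ H := H.sub_mem hh₂ hh₁
  obtain ⟨w, hw⟩ : ∃ w : Fin e ⊕ Fin e → K, r • w = h₂ - h₁ := by
    choose w hw using fun i => Ideal.mem_span_singleton'.mp (hJr ▸ hH.1 hdH i)
    exact ⟨w, funext fun i => by simpa [mul_comm] using hw i⟩
  have hw0 : r • w ≠ 0 := by
    rw [hw]
    intro h
    exact hab (by rw [sub_eq_zero.mp h])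
  have hra : r • (u + h₁) ∉ H := by
    have h0 : r • h₁ = 0 := funext fun i => (hann _).mpr (hH.1 hh₁ i)
    rwa [smul_add, h0, add_zero]
  obtain ⟨i, j, hD⟩ := exists_isUnit_minor hJr hJbot hJtop hideals ha' (hw ▸ hdH) hw0 hra
  have hb_eq : u + h₂ = (u + h₁) + r • w := by rw [hw]; abel
  set α := sympDual K e (u + h₁) with hα
  set ω := sympDual K e w with hω
  have hfa : ∀ c, sympForm K e c (u + h₁) = c ⬝ᵥ α := fun c => rfl
  have hfb : ∀ c, sympForm K e c (u + h₂) = c ⬝ᵥ α + r * (c ⬝ᵥ ω) := by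
    intro c
    rw [hb_eq, hα, hω]
    simp [sympForm, sympDual, mulVec_add, mulVec_smul]
  have hrJ : r ∈ J := hJr ▸ Ideal.mem_span_singleton_self r
  let A : Set (Fin e ⊕ Fin e → K) :=
    {c | (c ⬝ᵥ α ∈ J ∧ c ⬝ᵥ α ≠ 0) ∧ c ⬝ᵥ α + r * (c ⬝ᵥ ω) ≠ 0}
  let B : Set (Fin e ⊕ Fin e → K) := {c | (∀ i, c i ∈ J) ∧ c ⬝ᵥ α ≠ 0}
  have hBA : B ⊆ A := by
    rintro c ⟨hc, h0⟩
    have hmem : ∀ v : Fin e ⊕ Fin e → K, c ⬝ᵥ v ∈ J := fun v =>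
      J.sum_mem fun k _ => J.mul_mem_right _ (hc k)
    exact ⟨⟨hmem α, h0⟩, by rwa [(hann _).mpr (hmem ω), add_zero]⟩
  have hdiff : A \ B ⊆ unitTuples K e := by
    rintro c ⟨hcA, hcB⟩
    by_contra hc
    refine hcB ⟨fun k => ?_, hcA.1.2⟩
    by_contra hk
    exact hc ⟨k, (hunit _).mpr hk⟩
  have hadj : ∀ c, (adjY K J e (cls K e c) (cls K e (u + h₁)) ∧
      adjY K J e (cls K e c) (cls K e (u + h₂))) ↔ c ∈ A := by
    intro c
    rw [adjY_cls_iff, adjY_cls_iff, hfa, hfb]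
    exact ⟨fun h => ⟨h.1, h.2.2⟩,
      fun h => ⟨h.1, J.add_mem h.1.1 (J.mul_mem_right _ hrJ), h.2⟩⟩
  have hunitB : ∀ c ∈ unitTuples K e, c ∉ B := by
    rintro c ⟨k, hk⟩ hcB
    exact (hunit _).mp hk (hcB.1 k)
  have hset : {C ∈ classes K e | adjY K J e C (cls K e (u + h₁)) ∧
      adjY K J e C (cls K e (u + h₂))} = cls K e '' (A \ B) := by
    ext C
    constructor
    · rintro ⟨⟨c, hc, rfl⟩, h⟩
      exact ⟨c, ⟨(hadj c).mp h, hunitB c hc⟩, rfl⟩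
    · rintro ⟨c, hc, rfl⟩
      exact ⟨⟨c, hdiff hc, rfl⟩, (hadj c).mpr hc.1⟩
  have hsmul : ∀ (σ : Kˣ), ∀ c ∈ A \ B, σ • c ∈ A \ B := by
    intro σ c hc
    refine ⟨(hadj _).mp ?_, hunitB _ ?_⟩
    · rw [cls_units_smul]
      exact (hadj c).mpr hc.1
    · obtain ⟨k, hk⟩ := hdiff hc
      exact ⟨k, σ.isUnit.mul hk⟩
  have hNA : A.ncard * (Nat.card K * Nat.card J) = _ := ncard_tuples_forms_ne_zero hJr hD
  have hNB : B.ncard * Nat.card J = _ :=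
    ncard_ideal_tuples_form_ne_zero (exists_isUnit_sympDual ha')
  have hU := card_units_add_card hJtop hideals
  have hι : Nat.card (Fin e ⊕ Fin e) = 2 * e := by simp [two_mul]
  rw [Nat.card_fun, hcK, hcJ, hι] at hNA
  rw [Nat.card_fun, hcJ, hι] at hNB
  rw [hcK, hcJ] at hU
  rw [hset, Nat.card_coe_set_eq]
  exact common_neighbour_count_arith hq.two_le he (ncard_image_cls_mul_card_units hdiff hsmul) hU
    (Set.ncard_sdiff_add_ncard_of_subset hBA) hNB hNA
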